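/- Let w > 0 and r ≥ 0 be real numbers and set λ̄ = r/√w. Then the function g(α) = w·(log(1 + α) − α) + 2r·√(w(1 + α)) on [0, ∞) attains its maximum uniquely at α* = (λ̄² + λ̄·√(λ̄² + 4))/2; that is, g(α) ≤ g(α*) for all α ≥ 0, with equality only at α = α*. -/

import Mathlib

/-- Closed-form α-update (eq. (38)): for `w > 0`, `r ≥ 0` and `λ̄ = r/√w`, the
function `g(α) = w·(log(1+α) − α) + 2r·√(w(1+α))` on `[0, ∞)` attains its
maximum uniquely at `α* = (λ̄² + λ̄·√(λ̄² + 4))/2`. -/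
theorem alpha_update_optimal (w r : ℝ) (hw : 0 < w) (hr : 0 ≤ r) :
    let lb : ℝ := r / Real.sqrt w
    let αstar : ℝ := (lb ^ 2 + lb * Real.sqrt (lb ^ 2 + 4)) / 2
    let g : ℝ → ℝ := fun α =>
      w * (Real.log (1 + α) - α) + 2 * r * Real.sqrt (w * (1 + α))
    (∀ α : ℝ, 0 ≤ α → g α ≤ g αstar) ∧
      (∀ α : ℝ, 0 ≤ α → g α = g αstar → α = αstar) := by
  intro lb αstar g
  have hsw : 0 < Real.sqrt w := Real.sqrt_pos.mpr hw
  have hsw2 : Real.sqrt w * Real.sqrt w = w := Real.mul_self_sqrt hw.le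
  have hlb : 0 ≤ lb := div_nonneg hr hsw.le
  have hrl : r = lb * Real.sqrt w := by
    simp only [lb]; field_simp
  have hq2 : Real.sqrt (lb ^ 2 + 4) * Real.sqrt (lb ^ 2 + 4) = lb ^ 2 + 4 :=
    Real.mul_self_sqrt (by positivity)
  have hq : 0 < Real.sqrt (lb ^ 2 + 4) := Real.sqrt_pos.mpr (by positivity)
  obtain ⟨s, hs⟩ : ∃ s, s = (lb + Real.sqrt (lb ^ 2 + 4)) / 2 := ⟨_, rfl⟩
  have hs0 : 0 < s := by rw [hs]; linarith
  have hss : s ^ 2 = 1 + lb * s := by rw [hs]; nlinarith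
  have hα : αstar = s ^ 2 - 1 := by
    rw [hss, hs]; simp only [αstar]; ring
  have hg : ∀ t : ℝ, 0 < t →
      g (t ^ 2 - 1) = w * (2 * Real.log t - (t ^ 2 - 1) + 2 * lb * t) := by
    intro t ht
    have h1 : 1 + (t ^ 2 - 1) = t ^ 2 := by ring
    simp only [g]
    rw [h1, Real.log_pow, Real.sqrt_mul hw.le, Real.sqrt_sq ht.le]
    push_cast
    rw [hrl]
    linear_combination 2 * lb * t * hsw2
  have key : ∀ t : ℝ, 0 < t → g (t ^ 2 - 1) ≤ g αstar - w * (t - s) ^ 2 := by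
    intro t ht
    rw [hα, hg t ht, hg s hs0, ← mul_sub]
    apply mul_le_mul_of_nonneg_left _ hw.le
    have h1 := Real.log_le_sub_one_of_pos (div_pos ht hs0)
    rw [Real.log_div ht.ne' hs0.ne'] at h1
    have h2 : lb = s - 1 / s := by field_simp; linarith
    have h3 : 2 * lb * (t - s) = 2 * s * (t - s) - 2 * (t / s - 1) := by
      rw [h2]; field_simp
    nlinarith
  have rep : ∀ α : ℝ, 0 ≤ α → 0 < Real.sqrt (1 + α) ∧ α = Real.sqrt (1 + α) ^ 2 - 1 := by
    intro α h
    refine ⟨Real.sqrt_pos.mpr (by linarith), ?_⟩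
    rw [Real.sq_sqrt (by linarith)]; ring
  constructor
  · intro α h
    obtain ⟨h1, h2⟩ := rep α h
    have := key _ h1
    rw [← h2] at this
    nlinarith [mul_nonneg hw.le (sq_nonneg (Real.sqrt (1 + α) - s))]
  · intro α h he
    obtain ⟨h1, h2⟩ := rep α h
    have hk := key _ h1
    rw [← h2, he] at hk
    have h3 : (Real.sqrt (1 + α) - s) ^ 2 ≤ 0 := by
      by_contra hc
      have := mul_pos hw (not_le.mp hc)
      linarith
    have h4 : Real.sqrt (1 + α) - s = 0 := by
      have := le_antisymm h3 (sq_nonneg _)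
      exact pow_eq_zero_iff (two_ne_zero) |>.mp this
    rw [hα, h2, sub_eq_zero.mp h4]
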